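/- For every s ≥ 1 and every word b ∈ {1,2,3,4}^s, the set K(b) is a Cantor set whose thickness satisfies τ(K(b)) > 1.03. -/

import Mathlib

open Filter Set
open scoped Pointwise

noncomputable section

/-- The `n`-th convergent of the continued fraction `[0; a 0, a 1, a 2, …]`. -/
def cfConv : ℕ → (ℕ → ℕ) → ℝ
  | 0, _ => 0
  | n + 1, a => 1 / (a 0 + cfConv n fun i => a (i + 1))

/-- The value `[0; a 0, a 1, a 2, …]` of the infinite continued fraction with
partial quotients `a 0, a 1, …` (the limit of its convergents). -/
def cfVal (a : ℕ → ℕ) : ℝ := limUnder atTop fun n => cfConv n a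

/-- The sequence of partial quotients obtained by concatenating the finite word `b`
with the sequence `θ`. -/
def app (b : List ℕ) (θ : ℕ → ℕ) : ℕ → ℕ := fun n =>
  if h : n < b.length then b.get ⟨n, h⟩ else θ (n - b.length)

/-- The forbidden pairs of consecutive partial quotients. -/
def badPairs : Set (ℕ × ℕ) := {(1, 4), (2, 4)}

/-- The set `D` of sequences with entries in `{1,2,3,4}` avoiding the pairs
`(1,4)` and `(2,4)`. -/
def Dset : Set (ℕ → ℕ) :=
  {θ | (∀ n, θ n ∈ ({1, 2, 3, 4} : Set ℕ)) ∧ ∀ n, (θ n, θ (n + 1)) ∉ badPairs}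

/-- The Cantor set `K(b) = {[0; b, θ] : θ ∈ D, (b_s, θ_1) ∉ {(1,4),(2,4)}}`. -/
def Kb (b : List ℕ) : Set ℝ :=
  {x | ∃ θ ∈ Dset, (∀ d, b.getLast? = some d → (d, θ 0) ∉ badPairs) ∧
    x = cfVal (app b θ)}

/-- The set `K̃(b) ⊆ K(b)` of values `[0; b, θ]` with moreover `(θ_1, θ_2) ≠ (1,3)`. -/
def Ktil (b : List ℕ) : Set ℝ :=
  {x | ∃ θ ∈ Dset, (∀ d, b.getLast? = some d → (d, θ 0) ∉ badPairs) ∧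
    (θ 0, θ 1) ≠ (1, 3) ∧ x = cfVal (app b θ)}

/-- The word `b^s = (1,4)_s`. -/
def bW (s : ℕ) : List ℕ := (List.replicate s [1, 4]).flatten

/-- The word `c^s = (1,4)_{s-1}, 1, 3`. -/
def cW (s : ℕ) : List ℕ := bW (s - 1) ++ [1, 3]

/-- The periodic sequence `\overline{1,3}`. -/
def per13 : ℕ → ℕ := fun n => if n % 2 = 0 then 1 else 3

/-- The periodic sequence `\overline{3,1}`. -/
def per31 : ℕ → ℕ := fun n => if n % 2 = 0 then 3 else 1

/-- `Ioo a b` is a bounded gap of the compact set `K`: a bounded connected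
component of `ℝ \ K`. -/
def IsGap (K : Set ℝ) (a b : ℝ) : Prop :=
  a < b ∧ a ∈ K ∧ b ∈ K ∧ Set.Ioo a b ∩ K = ∅

/-- The length of the left bridge of the gap `Ioo a b` of `K`: the length of the
closed interval between the gap and the nearest gap to its left of length at least
`b - a` (the unbounded gap `(-∞, sInf K)`, of infinite length, always qualifying). -/
def leftBridgeLen (K : Set ℝ) (a b : ℝ) : ℝ :=
  a - sSup ({sInf K} ∪ {d | ∃ c, IsGap K c d ∧ d ≤ a ∧ b - a ≤ d - c})

/-- The length of the right bridge of the gap `Ioo a b` of `K`. -/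
def rightBridgeLen (K : Set ℝ) (a b : ℝ) : ℝ :=
  sInf ({sSup K} ∪ {c | ∃ d, IsGap K c d ∧ b ≤ c ∧ b - a ≤ d - c}) - b

/-- The thickness of `K`: the infimum over bounded gaps `U` of
`min (|L_U|, |R_U|) / |U|`. -/
def thickness (K : Set ℝ) : ℝ :=
  sInf {r | ∃ a b, IsGap K a b ∧
    r = min (leftBridgeLen K a b) (rightBridgeLen K a b) / (b - a)}

/-- A Cantor set: a compact, perfect, totally disconnected subset of `ℝ`. -/
def IsCantorSet (K : Set ℝ) : Prop :=
  IsCompact K ∧ Perfect K ∧ IsTotallyDisconnected K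

open scoped Topology

/-! ### Convergence of the continued fractions -/

/-- The sequences of partial quotients with all entries in `{1,2,3,4}`. -/
def digitSeqs : Set (ℕ → ℕ) := {a | ∀ n, a n ∈ ({1, 2, 3, 4} : Set ℕ)}

lemma digit_bounds {d : ℕ} (h : d ∈ ({1, 2, 3, 4} : Set ℕ)) : 1 ≤ d ∧ d ≤ 4 := by
  simp only [mem_insert_iff, mem_singleton_iff] at h
  omega

lemma digit_cast_bounds {d : ℕ} (h : d ∈ ({1, 2, 3, 4} : Set ℕ)) :
    (1 : ℝ) ≤ d ∧ (d : ℝ) ≤ 4 := by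
  obtain ⟨h1, h2⟩ := digit_bounds h
  exact ⟨by exact_mod_cast h1, by exact_mod_cast h2⟩

lemma digitSeqs_shift {a : ℕ → ℕ} (h : a ∈ digitSeqs) : (fun i => a (i + 1)) ∈ digitSeqs :=
  fun n => h (n + 1)

lemma cfConv_mem_Icc (n : ℕ) {a : ℕ → ℕ} (h : a ∈ digitSeqs) : cfConv n a ∈ Icc (0 : ℝ) 1 := by
  induction n generalizing a with
  | zero => simp [cfConv]
  | succ n ih =>
    obtain ⟨h0, -⟩ := ih (digitSeqs_shift h)
    obtain ⟨h1, -⟩ := digit_cast_bounds (h 0)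
    simp only [cfConv]
    refine ⟨by positivity, ?_⟩
    rw [div_le_one (by positivity)]
    linarith

lemma fifth_le_cfConv (n : ℕ) {a : ℕ → ℕ} (h : a ∈ digitSeqs) : 1 / 5 ≤ cfConv (n + 1) a := by
  obtain ⟨h0, h1⟩ := cfConv_mem_Icc n (digitSeqs_shift h)
  obtain ⟨h2, h3⟩ := digit_cast_bounds (h 0)
  simp only [cfConv]
  apply one_div_le_one_div_of_le <;> linarith

lemma abs_one_div_add_sub_le {k x y : ℝ} (hk : 1 ≤ k) (hx : 1 / 5 ≤ x) (hy : 1 / 5 ≤ y) :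
    |1 / (k + x) - 1 / (k + y)| ≤ 25 / 36 * |x - y| := by
  have h : 1 / (k + x) - 1 / (k + y) = (y - x) / ((k + x) * (k + y)) := by
    field_simp
    ring
  have h2 : 36 / 25 ≤ (k + x) * (k + y) := by nlinarith
  rw [h, abs_div, abs_of_pos (by linarith : 0 < (k + x) * (k + y)), abs_sub_comm,
    div_le_iff₀ (by linarith)]
  nlinarith [abs_nonneg (x - y)]

lemma abs_cfConv_sub_le (n m m' : ℕ) {a a' : ℕ → ℕ} (h : a ∈ digitSeqs) (h' : a' ∈ digitSeqs)
    (haa' : ∀ i < n, a i = a' i) :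
    |cfConv (m + 1 + n) a - cfConv (m' + 1 + n) a'| ≤ (25 / 36) ^ n := by
  induction n generalizing a a' with
  | zero =>
    have h1 := cfConv_mem_Icc (m + 1) h
    have h2 := cfConv_mem_Icc (m' + 1) h'
    rw [abs_le]
    constructor <;> simp only [add_zero, pow_zero] <;> linarith [h1.1, h1.2, h2.1, h2.2]
  | succ n ih =>
    have := ih (digitSeqs_shift h) (digitSeqs_shift h') fun i hi => haa' (i + 1) (by omega)
    rw [← add_assoc, ← add_assoc]
    simp only [cfConv]
    rw [← haa' 0 (by omega), pow_succ']
    refine (abs_one_div_add_sub_le (digit_cast_bounds (h 0)).1 ?_ ?_).trans (by gcongr)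
    · rw [add_right_comm]
      exact fifth_le_cfConv _ (digitSeqs_shift h)
    · rw [add_right_comm]
      exact fifth_le_cfConv _ (digitSeqs_shift h')

lemma tendsto_cfConv {a : ℕ → ℕ} (h : a ∈ digitSeqs) :
    Tendsto (fun n => cfConv n a) atTop (𝓝 (cfVal a)) := by
  have hc : CauchySeq fun n => cfConv (n + 1) a := by
    refine cauchySeq_of_le_geometric (25 / 36) 1 (by norm_num) fun n => ?_
    rw [Real.dist_eq, one_mul]
    have := abs_cfConv_sub_le n 0 1 h h fun _ _ => rfl
    convert this using 4 <;> ring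
  obtain ⟨l, hl⟩ := cauchySeq_tendsto_of_complete hc
  have hl' : Tendsto (fun n => cfConv n a) atTop (𝓝 l) := (tendsto_add_atTop_iff_nat 1).1 hl
  rwa [cfVal, hl'.limUnder_eq]

lemma cfVal_mem_Icc {a : ℕ → ℕ} (h : a ∈ digitSeqs) : cfVal a ∈ Icc (1 / 5 : ℝ) 1 := by
  have ht := (tendsto_add_atTop_iff_nat 1).2 (tendsto_cfConv h)
  exact ⟨ge_of_tendsto' ht fun n => fifth_le_cfConv n h,
    le_of_tendsto' ht fun n => (cfConv_mem_Icc (n + 1) h).2⟩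

lemma cfVal_eq {a : ℕ → ℕ} (h : a ∈ digitSeqs) :
    cfVal a = 1 / (a 0 + cfVal fun i => a (i + 1)) := by
  have h1 := digit_cast_bounds (h 0)
  have h2 := cfVal_mem_Icc (digitSeqs_shift h)
  refine tendsto_nhds_unique ((tendsto_add_atTop_iff_nat 1).2 (tendsto_cfConv h)) ?_
  simp only [cfConv]
  exact tendsto_const_nhds.div (tendsto_const_nhds.add (tendsto_cfConv (digitSeqs_shift h)))
    (by linarith [h1.1, h2.1])

lemma abs_cfVal_sub_le (n : ℕ) {a a' : ℕ → ℕ} (h : a ∈ digitSeqs) (h' : a' ∈ digitSeqs)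
    (haa' : ∀ i < n, a i = a' i) : |cfVal a - cfVal a'| ≤ (25 / 36) ^ n := by
  have key : ∀ {b : ℕ → ℕ}, b ∈ digitSeqs →
      Tendsto (fun m => cfConv (m + 1 + n) b) atTop (𝓝 (cfVal b)) := fun hb => by
    simpa only [add_assoc] using (tendsto_add_atTop_iff_nat (1 + n)).2 (tendsto_cfConv hb)
  exact le_of_tendsto' ((key h).sub (key h')).abs fun m => abs_cfConv_sub_le n m m h h' haa'

lemma continuousOn_cfVal : ContinuousOn cfVal digitSeqs := by
  intro a ha
  rw [ContinuousWithinAt, Metric.tendsto_nhds]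
  intro ε hε
  obtain ⟨n, hn⟩ := exists_pow_lt_of_lt_one hε (by norm_num : (25 / 36 : ℝ) < 1)
  have hev : ∀ᶠ a' in 𝓝 a, ∀ i ∈ Finset.range n, a' i = a i :=
    (Filter.eventually_all_finset _).2 fun i _ =>
      (continuous_apply i).continuousAt.eventually (discreteTopology_iff_forall_isOpen.1
        inferInstance {a i} |>.mem_nhds rfl)
  filter_upwards [hev.filter_mono nhdsWithin_le_nhds, self_mem_nhdsWithin] with a' h1 h2
  exact (abs_cfVal_sub_le n h2 ha fun i hi => h1 i (Finset.mem_range.2 hi)).trans_lt hn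

/-! ### Prepending digits -/

lemma app_nil (θ : ℕ → ℕ) : app [] θ = θ := by
  funext n
  simp [app]

lemma app_cons_zero (d : ℕ) (w : List ℕ) (θ : ℕ → ℕ) : app (d :: w) θ 0 = d := by
  simp [app]

lemma app_cons_succ (d : ℕ) (w : List ℕ) (θ : ℕ → ℕ) (n : ℕ) :
    app (d :: w) θ (n + 1) = app w θ n := by
  simp [app]

lemma app_mem_digitSeqs {w : List ℕ} (hw : ∀ d ∈ w, d ∈ ({1, 2, 3, 4} : Set ℕ)) {θ : ℕ → ℕ}
    (hθ : θ ∈ digitSeqs) : app w θ ∈ digitSeqs := by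
  intro n
  by_cases h : n < w.length
  · simpa [app, h] using hw _ (List.getElem_mem h)
  · simpa [app, h] using hθ _

lemma cfVal_app_cons {d : ℕ} {w : List ℕ} (hw : ∀ e ∈ d :: w, e ∈ ({1, 2, 3, 4} : Set ℕ))
    {θ : ℕ → ℕ} (hθ : θ ∈ digitSeqs) :
    cfVal (app (d :: w) θ) = 1 / (d + cfVal (app w θ)) := by
  rw [cfVal_eq (app_mem_digitSeqs hw hθ), app_cons_zero]
  simp only [app_cons_succ]

lemma Dset_shift {θ : ℕ → ℕ} (h : θ ∈ Dset) : (fun i => θ (i + 1)) ∈ Dset :=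
  ⟨fun n => h.1 (n + 1), fun n => h.2 (n + 1)⟩

lemma app_singleton_mem_Dset {k : ℕ} (hk : k ∈ ({1, 2, 3, 4} : Set ℕ)) {θ : ℕ → ℕ}
    (hθ : θ ∈ Dset) (h : (k, θ 0) ∉ badPairs) : app [k] θ ∈ Dset := by
  refine ⟨app_mem_digitSeqs (by simpa using hk) hθ.1, fun n => ?_⟩
  rw [app_cons_succ, app_nil]
  cases n with
  | zero => rwa [app_cons_zero]
  | succ n =>
    rw [app_cons_succ, app_nil]
    exact hθ.2 n

/-! ### The sets of admissible tails -/

/-- The values `[0; θ]` with `θ ∈ D` such that the digit `j` may be followed by `θ`. -/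
def tailSet (j : ℕ) : Set ℝ := {x | ∃ θ ∈ Dset, (j, θ 0) ∉ badPairs ∧ x = cfVal θ}

lemma mem_tailSet_iff {j : ℕ} {x : ℝ} : x ∈ tailSet j ↔
    ∃ k ∈ ({1, 2, 3, 4} : Set ℕ), (j, k) ∉ badPairs ∧ ∃ y ∈ tailSet k, x = 1 / (k + y) := by
  constructor
  · rintro ⟨θ, hθ, hj, rfl⟩
    exact ⟨θ 0, hθ.1 0, hj, _, ⟨_, Dset_shift hθ, hθ.2 0, rfl⟩, cfVal_eq hθ.1⟩
  · rintro ⟨k, hk, hj, y, ⟨θ, hθ, hkθ, rfl⟩, rfl⟩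
    refine ⟨app [k] θ, app_singleton_mem_Dset hk hθ hkθ, by rwa [app_cons_zero], ?_⟩
    rw [cfVal_app_cons (by simpa using hk) hθ.1, app_nil]

lemma one_div_add_mem_tailSet {j k : ℕ} (hk : k ∈ ({1, 2, 3, 4} : Set ℕ))
    (hjk : (j, k) ∉ badPairs) {y : ℝ} (hy : y ∈ tailSet k) : 1 / (k + y) ∈ tailSet j :=
  mem_tailSet_iff.2 ⟨k, hk, hjk, y, hy, rfl⟩

lemma tailSet_subset_Icc (j : ℕ) : tailSet j ⊆ Icc (1 / 5) 1 := by
  rintro x ⟨θ, hθ, -, rfl⟩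
  exact cfVal_mem_Icc hθ.1

/-- The number `[0; 1, 3, 1, 3, …]`, the largest value taken on `D`. -/
def cfMax : ℝ := (√21 - 3) / 2

lemma cfMax_sq : cfMax ^ 2 = 3 - 3 * cfMax := by
  have h := Real.sq_sqrt (show (0 : ℝ) ≤ 21 by norm_num)
  unfold cfMax
  linarith

lemma lt_cfMax : 0.79128 < cfMax := by
  have : (4.58256 : ℝ) < √21 := Real.lt_sqrt_of_sq_lt (by norm_num)
  unfold cfMax
  linarith

lemma cfMax_lt : cfMax < 0.79129 := by
  have : √21 < (4.58258 : ℝ) := (Real.sqrt_lt' (by norm_num)).2 (by norm_num)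
  unfold cfMax
  linarith

/-- The smallest element of `tailSet j`. -/
def tailMin (j : ℕ) : ℝ := if j ≤ 2 then cfMax / 3 else 1 - cfMax

lemma one_div_three_add_cfMax : 1 / (3 + cfMax) = cfMax / 3 := by
  have := lt_cfMax
  rw [div_eq_div_iff (by linarith) (by norm_num)]
  linarith [cfMax_sq]

lemma one_div_four_add_cfMax : 1 / (4 + cfMax) = 1 - cfMax := by
  have := lt_cfMax
  rw [div_eq_iff (by linarith)]
  linarith [cfMax_sq]

lemma le_cfMax_of_mem_tailSet {j : ℕ} {x : ℝ} (hx : x ∈ tailSet j) : x ≤ cfMax := by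
  set T : Set ℝ := cfVal '' Dset with hT
  have hbdd : BddAbove T := by
    refine ⟨1, ?_⟩
    rintro - ⟨θ, hθ, rfl⟩
    exact (cfVal_mem_Icc hθ.1).2
  obtain ⟨θ, hθ, -, rfl⟩ := hx
  have hle : ∀ θ ∈ Dset, cfVal θ ≤ sSup T := fun θ hθ => le_csSup hbdd ⟨θ, hθ, rfl⟩
  have hpos : 0 ≤ sSup T := (by norm_num : (0 : ℝ) ≤ 1 / 5).trans
    ((cfVal_mem_Icc hθ.1).1.trans (hle θ hθ))
  have hS : sSup T ≤ (3 + sSup T) / (4 + sSup T) := by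
    refine csSup_le ⟨_, θ, hθ, rfl⟩ ?_
    rintro - ⟨η, hη, rfl⟩
    have h1 := cfVal_mem_Icc (Dset_shift hη).1
    rw [cfVal_eq hη.1]
    rcases (digit_bounds (hη.1 0)).1.eq_or_lt with h | h
    · have h3 : η 1 ≤ 3 := by
        have := (digit_bounds (hη.1 1)).2
        have h4 := hη.2 0
        rw [← h] at h4
        by_contra hc
        exact h4 (by simp [badPairs, show η 1 = 4 by omega])
      have h3' : (η 1 : ℝ) ≤ 3 := by exact_mod_cast h3
      have h3'' := (digit_cast_bounds (hη.1 1)).1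
      have h5 := hle _ (Dset_shift (Dset_shift hη))
      have h6 := cfVal_mem_Icc (Dset_shift (Dset_shift hη)).1
      have h7 : 1 / (3 + sSup T) ≤ cfVal fun i => η (i + 1) := by
        rw [cfVal_eq (Dset_shift hη).1]
        apply one_div_le_one_div_of_le <;> simp only [zero_add] <;> linarith [h6.1]
      have h8 : (3 + sSup T) / (4 + sSup T) = 1 / (1 + 1 / (3 + sSup T)) := by
        field_simp
        ring
      rw [← h, h8, Nat.cast_one]
      apply one_div_le_one_div_of_le
      · positivity
      · linarith
    · have h2 : (2 : ℝ) ≤ η 0 := by exact_mod_cast h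
      rw [div_le_div_iff₀ (by linarith [h1.1]) (by linarith)]
      nlinarith [h1.1]
  rw [le_div_iff₀ (by linarith)] at hS
  refine (hle θ hθ).trans ?_
  by_contra! hc
  nlinarith [cfMax_sq, lt_cfMax]

lemma per13_mem_Dset : per13 ∈ Dset := by
  refine ⟨fun n => ?_, fun n => ?_⟩
  · simp only [per13]
    split_ifs <;> simp
  · simp only [per13, badPairs]
    split_ifs <;> simp

lemma cfVal_per13 : cfVal per13 = cfMax := by
  have h := per13_mem_Dset
  have h1 := cfVal_eq h.1
  rw [cfVal_eq (digitSeqs_shift h.1)] at h1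
  have h2 : (fun i => per13 (i + 1 + 1)) = per13 := by
    funext i
    simp only [per13]
    congr 2
    omega
  have h3 := (cfVal_mem_Icc h.1).1
  rw [h2, show per13 0 = 1 from rfl, show per13 (0 + 1) = 3 from rfl] at h1
  push_cast at h1
  have h4 : cfVal per13 * (4 + cfVal per13) = 3 + cfVal per13 := by
    have : 1 / (1 + 1 / (3 + cfVal per13)) = (3 + cfVal per13) / (4 + cfVal per13) := by
      field_simp
      ring
    rw [this, eq_div_iff (by linarith)] at h1
    exact h1
  have h5 : (cfVal per13 - cfMax) * (cfVal per13 + cfMax + 3) = 0 := by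
    linear_combination h4 - cfMax_sq
  rcases mul_eq_zero.1 h5 with h6 | h6
  · linarith
  · linarith [lt_cfMax]

lemma cfMax_mem_tailSet (j : ℕ) : cfMax ∈ tailSet j :=
  ⟨per13, per13_mem_Dset, by simp [per13, badPairs], cfVal_per13.symm⟩

lemma tailMin_mem_tailSet {j : ℕ} : tailMin j ∈ tailSet j := by
  unfold tailMin
  split_ifs with h
  · have := one_div_add_mem_tailSet (j := j) (k := 3) (by simp) (by simp [badPairs])
      (cfMax_mem_tailSet 3)
    rwa [Nat.cast_ofNat, one_div_three_add_cfMax] at this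
  · have := one_div_add_mem_tailSet (j := j) (k := 4) (by simp)
      (by simp only [badPairs, mem_insert_iff, mem_singleton_iff, Prod.mk.injEq]; omega)
      (cfMax_mem_tailSet 4)
    rwa [Nat.cast_ofNat, one_div_four_add_cfMax] at this

lemma tailMin_le {j : ℕ} (hj : 1 ≤ j) {x : ℝ} (hx : x ∈ tailSet j) : tailMin j ≤ x := by
  obtain ⟨k, hk, hjk, y, hy, rfl⟩ := mem_tailSet_iff.1 hx
  have h1 := le_cfMax_of_mem_tailSet hy
  have h2 := (tailSet_subset_Icc k hy).1
  obtain ⟨h3, h4⟩ := digit_cast_bounds hk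
  unfold tailMin
  split_ifs with h
  · have hk3 : k ≤ 3 := by
      have := digit_bounds hk
      simp only [badPairs, mem_insert_iff, mem_singleton_iff, Prod.mk.injEq] at hjk
      omega
    have hk3' : (k : ℝ) ≤ 3 := by exact_mod_cast hk3
    rw [← one_div_three_add_cfMax]
    apply one_div_le_one_div_of_le <;> linarith
  · rw [← one_div_four_add_cfMax]
    apply one_div_le_one_div_of_le <;> linarith

lemma tailSet_pos {j : ℕ} {x : ℝ} (hx : x ∈ tailSet j) : 0 < x := by
  linarith [(tailSet_subset_Icc j hx).1]

lemma tailSet_lt_one {j : ℕ} {x : ℝ} (hx : x ∈ tailSet j) : x < 1 := by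
  linarith [le_cfMax_of_mem_tailSet hx, cfMax_lt]

lemma eq_of_one_div_add_mem_Icc {j k l : ℕ} {x y z : ℝ} (hx : x ∈ tailSet j) (hy : y ∈ tailSet j)
    (hz : z ∈ tailSet l) (hl : 1 ≤ l) (h1 : 1 / (k + x) ≤ 1 / (l + z))
    (h2 : 1 / (l + z) ≤ 1 / ((k : ℝ) + y)) : l = k := by
  have hx0 := tailSet_pos hx
  have hy0 := tailSet_pos hy
  have hz0 := tailSet_pos hz
  have hx1 := tailSet_lt_one hx
  have hz1 := tailSet_lt_one hz
  rw [one_div_le_one_div (by positivity) (by positivity)] at h1 h2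
  have h3 : (l : ℝ) < (k + 1 : ℕ) := by push_cast; linarith
  have h4 : (k : ℝ) < (l + 1 : ℕ) := by push_cast; linarith
  have h3' := Nat.cast_lt.1 h3
  have h4' := Nat.cast_lt.1 h4
  omega

lemma cfVal_injOn : InjOn cfVal Dset := by
  intro θ hθ η hη h
  funext n
  induction n generalizing θ η with
  | zero =>
    rw [cfVal_eq hθ.1, cfVal_eq hη.1] at h
    have h1 : (cfVal fun i => θ (i + 1)) ∈ tailSet (θ 0) := ⟨_, Dset_shift hθ, hθ.2 0, rfl⟩
    have h2 : (cfVal fun i => η (i + 1)) ∈ tailSet (η 0) := ⟨_, Dset_shift hη, hη.2 0, rfl⟩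
    exact eq_of_one_div_add_mem_Icc h2 h2 h1 (digit_bounds (hθ.1 0)).1 h.ge h.le
  | succ n ih =>
    refine ih (Dset_shift hθ) (Dset_shift hη) ?_
    have h1 : (cfVal fun i => θ (i + 1)) ∈ tailSet (θ 0) := ⟨_, Dset_shift hθ, hθ.2 0, rfl⟩
    have h2 : (cfVal fun i => η (i + 1)) ∈ tailSet (η 0) := ⟨_, Dset_shift hη, hη.2 0, rfl⟩
    rw [cfVal_eq hθ.1, cfVal_eq hη.1] at h
    have h0 := eq_of_one_div_add_mem_Icc h2 h2 h1 (digit_bounds (hθ.1 0)).1 h.ge h.le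
    have p1 := tailSet_pos h1
    have p2 := tailSet_pos h2
    rw [h0, one_div, one_div, inv_inj] at h
    linarith

/-! ### Gaps and bridges for a length function -/

lemma IsGap.le_or_ge {K : Set ℝ} {u v p : ℝ} (h : IsGap K u v) (hp : p ∈ K) : v ≤ p ∨ p ≤ u := by
  by_contra! hc
  have : p ∈ Ioo u v ∩ K := ⟨⟨hc.2, hc.1⟩, hp⟩
  rw [h.2.2.2] at this
  exact this

/-- The gap `Ioo u v` of `K` has, for the length function `ρ`, a bridge on its left which is at
least `τ` times as long as the gap and only contains gaps shorter than `Ioo u v`. -/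
def HasLeftBridge (ρ : ℝ → ℝ → ℝ) (τ : ℝ) (K : Set ℝ) (u v : ℝ) : Prop :=
  ∃ p ∈ K, p ≤ u ∧ τ * ρ u v ≤ ρ p u ∧
    ∀ u' v', IsGap K u' v' → p ≤ u' → v' ≤ u → ρ u' v' < ρ u v

/-- The gap `Ioo u v` of `K` has, for the length function `ρ`, a bridge on its right which is at
least `τ` times as long as the gap and only contains gaps shorter than `Ioo u v`. -/
def HasRightBridge (ρ : ℝ → ℝ → ℝ) (τ : ℝ) (K : Set ℝ) (u v : ℝ) : Prop :=
  ∃ p ∈ K, v ≤ p ∧ τ * ρ u v ≤ ρ v p ∧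
    ∀ u' v', IsGap K u' v' → v ≤ u' → v' ≤ p → ρ u' v' < ρ u v

section Transfer

variable {A B : Set ℝ} {f : ℝ → ℝ} {ρ ρ' : ℝ → ℝ → ℝ} {l τ x y : ℝ}

lemma IsGap.of_image (hanti : StrictAntiOn f A) (hmaps : MapsTo f A B) (hx : x ∈ A) (hy : y ∈ A)
    (h : IsGap B (f y) (f x)) : IsGap A x y := by
  refine ⟨(hanti.lt_iff_gt hy hx).1 h.1, hx, hy, ?_⟩
  rw [eq_empty_iff_forall_notMem]
  rintro z ⟨⟨h1, h2⟩, hz⟩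
  rcases h.le_or_ge (hmaps hz) with h3 | h3
  · exact h3.not_gt (hanti hx hz h1)
  · exact h3.not_gt (hanti hz hy h2)

lemma exists_isGap_of_mem_image (hanti : StrictAntiOn f A) (hmaps : MapsTo f A B)
    (hconv : ∀ x ∈ A, ∀ y ∈ A, ∀ w ∈ B, f x ≤ w → w ≤ f y → w ∈ f '' A) (hx : x ∈ A) (hy : y ∈ A)
    {u v : ℝ} (h : IsGap B u v) (hu : f x ≤ u) (hv : v ≤ f y) :
    ∃ s ∈ A, ∃ t ∈ A, u = f t ∧ v = f s ∧ IsGap A s t ∧ t ≤ x ∧ y ≤ s := by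
  obtain ⟨t, ht, rfl⟩ := hconv x hx y hy u h.2.1 hu (h.1.le.trans hv)
  obtain ⟨s, hs, rfl⟩ := hconv x hx y hy v h.2.2.1 (hu.trans h.1.le) hv
  exact ⟨s, hs, t, ht, rfl, rfl, h.of_image hanti hmaps hs ht, (hanti.le_iff_ge hx ht).1 hu,
    (hanti.le_iff_ge hs hy).1 hv⟩

lemma HasLeftBridge.image (hanti : StrictAntiOn f A) (hmaps : MapsTo f A B)
    (hconv : ∀ x ∈ A, ∀ y ∈ A, ∀ w ∈ B, f x ≤ w → w ≤ f y → w ∈ f '' A)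
    (hl : 0 < l) (hρ : ∀ x ∈ A, ∀ y ∈ A, ρ' (f y) (f x) = l * ρ x y)
    (hx : x ∈ A) (hy : y ∈ A) (h : HasLeftBridge ρ τ A x y) :
    HasRightBridge ρ' τ B (f y) (f x) := by
  obtain ⟨p, hp, hpx, h1, h2⟩ := h
  refine ⟨f p, hmaps hp, hanti.antitoneOn hp hx hpx, ?_, fun u v huv hu hv => ?_⟩
  · rw [hρ x hx y hy, hρ p hp x hx, mul_left_comm]
    gcongr
  · obtain ⟨s, hs, t, ht, rfl, rfl, hst, h3, h4⟩ :=
      exists_isGap_of_mem_image hanti hmaps hconv hx hp huv hu hv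
    rw [hρ x hx y hy, hρ s hs t ht]
    exact mul_lt_mul_of_pos_left (h2 s t hst h4 h3) hl

lemma HasRightBridge.image (hanti : StrictAntiOn f A) (hmaps : MapsTo f A B)
    (hconv : ∀ x ∈ A, ∀ y ∈ A, ∀ w ∈ B, f x ≤ w → w ≤ f y → w ∈ f '' A)
    (hl : 0 < l) (hρ : ∀ x ∈ A, ∀ y ∈ A, ρ' (f y) (f x) = l * ρ x y)
    (hx : x ∈ A) (hy : y ∈ A) (h : HasRightBridge ρ τ A x y) :
    HasLeftBridge ρ' τ B (f y) (f x) := by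
  obtain ⟨p, hp, hpy, h1, h2⟩ := h
  refine ⟨f p, hmaps hp, hanti.antitoneOn hy hp hpy, ?_, fun u v huv hu hv => ?_⟩
  · rw [hρ x hx y hy, hρ y hy p hp, mul_left_comm]
    gcongr
  · obtain ⟨s, hs, t, ht, rfl, rfl, hst, h3, h4⟩ :=
      exists_isGap_of_mem_image hanti hmaps hconv hp hy huv hu hv
    rw [hρ x hx y hy, hρ s hs t ht]
    exact mul_lt_mul_of_pos_left (h2 s t hst h4 h3) hl

end Transfer

/-- The length of the image of `[x, y]` under `t ↦ 1 / (c + t)`. -/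
def moebiusLen (c x y : ℝ) : ℝ := 1 / (c + x) - 1 / (c + y)

lemma moebiusLen_one_div_add {c k x y : ℝ} (hc : 0 < c) (hk : 0 ≤ k) (hx : 0 < x) (hy : 0 < y) :
    moebiusLen c (1 / (k + y)) (1 / (k + x)) = 1 / c ^ 2 * moebiusLen (k + 1 / c) x y := by
  have h1 : c * k + c * x + 1 ≠ 0 := by positivity
  have h2 : c * k + c * y + 1 ≠ 0 := by positivity
  have e : ∀ t, 0 < t → 1 / (c + 1 / (k + t)) = 1 / c - 1 / c ^ 2 * (1 / (k + 1 / c + t)) := by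
    intro t ht
    have h3 : c * (k + t) + 1 ≠ 0 := by positivity
    have h4 : k * c + 1 + t * c ≠ 0 := by positivity
    field_simp
    ring
  rw [moebiusLen, moebiusLen, e x hx, e y hy]
  ring

lemma strictAntiOn_one_div_add {k : ℝ} (hk : 0 ≤ k) {A : Set ℝ} (hA : ∀ x ∈ A, 0 < x) :
    StrictAntiOn (fun x => 1 / (k + x)) A := fun x hx y _ hxy =>
  one_div_lt_one_div_of_lt (by linarith [hA x hx]) (by linarith)

lemma moebiusLen_lt_of_mul_lt {c x y u v : ℝ} (hx : 0 < c + x) (hy : 0 < c + y) (hu : 0 < c + u)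
    (hv : 0 < c + v) (h : (y - x) * ((c + u) * (c + v)) < (v - u) * ((c + x) * (c + y))) :
    moebiusLen c x y < moebiusLen c u v := by
  have e : ∀ a b : ℝ, 0 < c + a → 0 < c + b →
      moebiusLen c a b = (b - a) / ((c + a) * (c + b)) := by
    intro a b ha hb
    unfold moebiusLen
    field_simp
    ring
  rw [e x y hx hy, e u v hu hv, div_lt_div_iff₀ (by positivity) (by positivity)]
  exact h

lemma moebiusLen_mono {c x y u v : ℝ} (hu : 0 < c + u) (hux : u ≤ x) (hxy : x ≤ y) (hyv : y ≤ v) :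
    moebiusLen c x y ≤ moebiusLen c u v := by
  have h1 := one_div_le_one_div_of_le hu (by linarith : c + u ≤ c + x)
  have h2 := one_div_le_one_div_of_le (by linarith : 0 < c + y) (by linarith : c + y ≤ c + v)
  unfold moebiusLen
  linarith

lemma mul_moebiusLen_le_left {c p u v τ : ℝ} (hp : 0 < c + p) (hpu : p ≤ u) (huv : u ≤ v)
    (h : τ * ((v - u) * (c + p)) ≤ (u - p) * (c + v)) :
    τ * moebiusLen c u v ≤ moebiusLen c p u := by
  have hu : 0 < c + u := by linarith
  have hv : 0 < c + v := by linarith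
  have e1 : moebiusLen c u v = ((v - u) * (c + p)) / ((c + p) * (c + u) * (c + v)) := by
    unfold moebiusLen
    field_simp
    ring
  have e2 : moebiusLen c p u = ((u - p) * (c + v)) / ((c + p) * (c + u) * (c + v)) := by
    unfold moebiusLen
    field_simp
    ring
  rw [e1, e2, ← mul_div_assoc]
  gcongr

lemma mul_moebiusLen_le_right {c p u v τ : ℝ} (hu : 0 < c + u) (huv : u ≤ v) (hvp : v ≤ p)
    (h : τ * ((v - u) * (c + p)) ≤ (p - v) * (c + u)) :
    τ * moebiusLen c u v ≤ moebiusLen c v p := by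
  have hv : 0 < c + v := by linarith
  have hp : 0 < c + p := by linarith
  have e1 : moebiusLen c u v = ((v - u) * (c + p)) / ((c + u) * (c + v) * (c + p)) := by
    unfold moebiusLen
    field_simp
    ring
  have e2 : moebiusLen c v p = ((p - v) * (c + u)) / ((c + u) * (c + v) * (c + p)) := by
    unfold moebiusLen
    field_simp
    ring
  rw [e1, e2, ← mul_div_assoc]
  gcongr

lemma moebiusLen_lt_of_box {c x y u v x₀ y₀ u₀ v₀ : ℝ} (hc : 1 ≤ c) (hx₀ : 0 < x₀) (hu : 0 < u)
    (hx : x₀ ≤ x) (hxy : x ≤ y) (hy : y ≤ y₀) (hu₀ : u ≤ u₀) (huv : u₀ ≤ v₀) (hv : v₀ ≤ v)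
    (h0 : y₀ - x₀ ≤ v₀ - u₀)
    (h1 : (y₀ - x₀) * (2 + u₀ + v₀) ≤ (v₀ - u₀) * (2 + x₀ + y₀))
    (h2 : (y₀ - x₀) * ((1 + u₀) * (1 + v₀)) < (v₀ - u₀) * ((1 + x₀) * (1 + y₀))) :
    moebiusLen c x y < moebiusLen c u v := by
  refine (moebiusLen_mono (by linarith) hx hxy hy).trans_lt
    (lt_of_lt_of_le ?_ (moebiusLen_mono (by linarith) hu₀ huv hv))
  apply moebiusLen_lt_of_mul_lt <;> try linarith
  have hc' : 0 ≤ c - 1 := by linarith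
  nlinarith [mul_le_mul_of_nonneg_right h0 (sq_nonneg (c - 1)), mul_le_mul_of_nonneg_right h1 hc']

lemma le_of_endpoints {τ a b p q c : ℝ} (hc1 : 1 ≤ c) (hc5 : c ≤ 5)
    (h1 : τ * (a * (1 + p)) ≤ b * (1 + q)) (h5 : τ * (a * (5 + p)) ≤ b * (5 + q)) :
    τ * (a * (c + p)) ≤ b * (c + q) := by
  nlinarith [mul_le_mul_of_nonneg_left h1 (sub_nonneg.2 hc5),
    mul_le_mul_of_nonneg_left h5 (sub_nonneg.2 hc1)]

/-! ### The gaps of the sets of admissible tails -/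

lemma not_mem_badPairs {j k : ℕ} (hk : k ≤ 3) : (j, k) ∉ badPairs := by
  simp only [badPairs, mem_insert_iff, mem_singleton_iff, Prod.mk.injEq]
  omega

lemma mem_image_tailSet {j k : ℕ} :
    ∀ x ∈ tailSet k, ∀ y ∈ tailSet k, ∀ w ∈ tailSet j, 1 / (k + x) ≤ w → w ≤ 1 / (k + y) →
      w ∈ (fun t => 1 / ((k : ℝ) + t)) '' tailSet k := by
  intro x hx y hy w hw h1 h2
  obtain ⟨l, hl, -, z, hz, rfl⟩ := mem_tailSet_iff.1 hw
  obtain rfl := eq_of_one_div_add_mem_Icc hx hy hz (digit_bounds hl).1 h1 h2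
  exact ⟨z, hz, rfl⟩

lemma strictAntiOn_tailSet (j k : ℕ) : StrictAntiOn (fun t => 1 / ((k : ℝ) + t)) (tailSet j) :=
  strictAntiOn_one_div_add k.cast_nonneg fun _ hx => tailSet_pos hx

lemma mapsTo_tailSet {j k : ℕ} (hk : k ∈ ({1, 2, 3, 4} : Set ℕ)) (hjk : (j, k) ∉ badPairs) :
    MapsTo (fun t => 1 / ((k : ℝ) + t)) (tailSet k) (tailSet j) :=
  fun _ hx => one_div_add_mem_tailSet hk hjk hx

/-- Every gap of `tailSet j` lies between two adjacent cylinders, or is the image of a gap of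
some `tailSet k`. -/
lemma isGap_tailSet_cases {j : ℕ} {u v : ℝ} (h : IsGap (tailSet j) u v) :
    (∃ b ∈ ({1, 2, 3} : Set ℕ), (j, b + 1) ∉ badPairs ∧
      u = 1 / ((b + 1 : ℕ) + tailMin (b + 1)) ∧ v = 1 / (b + cfMax)) ∨
    ∃ k ∈ ({1, 2, 3, 4} : Set ℕ), (j, k) ∉ badPairs ∧ ∃ x y, IsGap (tailSet k) x y ∧
      u = 1 / (k + y) ∧ v = 1 / (k + x) := by
  obtain ⟨a, ha, hja, x, hx, rfl⟩ := mem_tailSet_iff.1 h.2.1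
  obtain ⟨b, hb, hjb, y, hy, rfl⟩ := mem_tailSet_iff.1 h.2.2.1
  obtain ⟨ha1, ha4⟩ := digit_bounds ha
  obtain ⟨hb1, hb4⟩ := digit_bounds hb
  have hx0 := tailSet_pos hx
  have hx1 := tailSet_lt_one hx
  have hy0 := tailSet_pos hy
  have hy1 := tailSet_lt_one hy
  have hM := lt_cfMax
  have hM' := cfMax_lt
  have hlt := (one_div_lt_one_div (by positivity) (by positivity)).1 h.1
  rcases eq_or_ne a b with rfl | hab
  · exact Or.inr ⟨a, ha, hja, y, x,
      h.of_image (strictAntiOn_tailSet a a) (mapsTo_tailSet ha hja) hy hx, rfl, rfl⟩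
  · left
    have hba : b < a := by
      have : (b : ℝ) < (a + 1 : ℕ) := by push_cast; linarith
      have := Nat.cast_lt.1 this
      omega
    have hab' : a = b + 1 := by
      by_contra hne
      have h2 : ((b + 2 : ℕ) : ℝ) ≤ a := Nat.cast_le.2 (by omega)
      push_cast at h2
      have hmem := one_div_add_mem_tailSet (j := j) (k := b + 1)
        (by simp only [mem_insert_iff, mem_singleton_iff]; omega)
        (not_mem_badPairs (by omega)) (cfMax_mem_tailSet _)
      rcases h.le_or_ge hmem with h3 | h3
      · rw [one_div_le_one_div (by positivity) (by positivity)] at h3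
        push_cast at h3
        linarith
      · rw [one_div_le_one_div (by positivity) (by positivity)] at h3
        push_cast at h3
        linarith
    subst hab'
    have hm0 := tailSet_pos (tailMin_mem_tailSet (j := b + 1))
    have hmx := tailMin_le ha1 hx
    have hyM := le_cfMax_of_mem_tailSet hy
    refine ⟨b, by simp only [mem_insert_iff, mem_singleton_iff]; omega, hja, ?_, ?_⟩
    · rcases h.le_or_ge (one_div_add_mem_tailSet ha hja tailMin_mem_tailSet) with h3 | h3
      · rw [one_div_le_one_div (by positivity) (by positivity)] at h3
        push_cast at h3
        linarith
      · refine le_antisymm ?_ h3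
        apply one_div_le_one_div_of_le <;> linarith
    · rcases h.le_or_ge (one_div_add_mem_tailSet hb hjb (cfMax_mem_tailSet b)) with h3 | h3
      · refine le_antisymm h3 ?_
        apply one_div_le_one_div_of_le <;> linarith
      · rw [one_div_le_one_div (by positivity) (by positivity)] at h3
        push_cast at h3
        linarith

lemma tailSet_gap_induction {P : ℕ → ℝ → ℝ → Prop}
    (base : ∀ j, ∀ b ∈ ({1, 2, 3} : Set ℕ), (j, b + 1) ∉ badPairs →
      P j (1 / ((b + 1 : ℕ) + tailMin (b + 1))) (1 / (b + cfMax)))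
    (step : ∀ j, ∀ k ∈ ({1, 2, 3, 4} : Set ℕ), (j, k) ∉ badPairs → ∀ x y,
      IsGap (tailSet k) x y → P k x y → P j (1 / (k + y)) (1 / (k + x)))
    {j : ℕ} {u v : ℝ} (h : IsGap (tailSet j) u v) : P j u v := by
  obtain ⟨n, hn⟩ := exists_pow_lt_of_lt_one (sub_pos.2 h.1) (by norm_num : (25 / 36 : ℝ) < 1)
  induction n generalizing j u v with
  | zero =>
    have h1 := tailSet_subset_Icc j h.2.1
    have h2 := tailSet_subset_Icc j h.2.2.1
    rw [pow_zero] at hn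
    linarith [h1.1, h2.2]
  | succ n ih =>
    rcases isGap_tailSet_cases h with ⟨b, hb, hjb, rfl, rfl⟩ | ⟨k, hk, hjk, x, y, hxy, rfl, rfl⟩
    · exact base j b hb hjb
    · refine step j k hk hjk x y hxy (ih hxy ?_)
      have h1 := abs_one_div_add_sub_le (digit_cast_bounds hk).1
        (tailSet_subset_Icc k hxy.2.1).1 (tailSet_subset_Icc k hxy.2.2.1).1
      rw [abs_of_pos (sub_pos.2 h.1), abs_sub_comm, abs_of_pos (sub_pos.2 hxy.1)] at h1
      rw [pow_succ'] at hn
      linarith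

lemma one_div_one_add_cfMax : 1 / (1 + cfMax) = (cfMax + 2) / 5 := by
  have := lt_cfMax
  rw [div_eq_iff (by linarith)]
  linarith [cfMax_sq]

lemma one_div_two_add_cfMax : 1 / (2 + cfMax) = (cfMax + 1) / 5 := by
  have := lt_cfMax
  rw [div_eq_iff (by linarith)]
  linarith [cfMax_sq]

lemma one_div_one_add_tailMin : 1 / (1 + tailMin 1) = cfMax := by
  have := lt_cfMax
  simp only [tailMin, Nat.one_le_ofNat, if_true]
  rw [div_eq_iff (by linarith)]
  linarith [cfMax_sq]

lemma one_div_two_add_tailMin : 1 / (2 + tailMin 2) = (3 - cfMax) / 5 := by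
  have := lt_cfMax
  simp only [tailMin, le_refl, if_true]
  rw [div_eq_iff (by linarith)]
  linarith [cfMax_sq]

lemma one_div_three_add_tailMin : 1 / (3 + tailMin 3) = (cfMax + 7) / 25 := by
  have := cfMax_lt
  simp only [tailMin, Nat.reduceLeDiff, if_false]
  rw [div_eq_iff (by linarith)]
  linarith [cfMax_sq]

lemma one_div_four_add_tailMin : 1 / (4 + tailMin 4) = (cfMax + 8) / 37 := by
  have := cfMax_lt
  simp only [tailMin, Nat.reduceLeDiff, if_false]
  rw [div_eq_iff (by linarith)]
  linarith [cfMax_sq]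

/-- The image of the largest gap under `t ↦ 1 / (k + t)`, in rational bounds. -/
lemma largest_gap_image_bounds {k x₀ y₀ : ℝ} (hk : 1 ≤ k) (hx₀ : 0 < x₀) (hy₀ : 0 < y₀)
    (h1 : x₀ * (k + 0.55826) ≤ 1) (h2 : 1 ≤ y₀ * (k + 0.44174)) :
    x₀ ≤ 1 / (k + (cfMax + 2) / 5) ∧ 1 / (k + (cfMax + 2) / 5) ≤ 1 / (k + (3 - cfMax) / 5) ∧
      1 / (k + (3 - cfMax) / 5) ≤ y₀ := by
  have hM := lt_cfMax
  have hM' := cfMax_lt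
  refine ⟨?_, ?_, ?_⟩
  · rw [le_div_iff₀ (by linarith)]
    nlinarith
  · apply one_div_le_one_div_of_le <;> linarith
  · rw [div_le_iff₀ (by linarith)]
    nlinarith

lemma moebiusLen_image_one_lt {c : ℝ} (hc : 1 ≤ c) :
    moebiusLen c (1 / (1 + (cfMax + 2) / 5)) (1 / (1 + (3 - cfMax) / 5)) <
      moebiusLen c ((3 - cfMax) / 5) ((cfMax + 2) / 5) := by
  have hM := lt_cfMax
  have hM' := cfMax_lt
  obtain ⟨h1, h2, h3⟩ := largest_gap_image_bounds (k := 1) (x₀ := 0.6417) (y₀ := 0.6937)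
    (by norm_num) (by norm_num) (by norm_num) (by norm_num) (by norm_num)
  apply moebiusLen_lt_of_box (u₀ := 0.4418) (v₀ := 0.5582) hc _ _ h1 h2 h3 <;>
    linarith

lemma moebiusLen_image_two_lt {c : ℝ} (hc : 1 ≤ c) :
    moebiusLen c (1 / (2 + (cfMax + 2) / 5)) (1 / (2 + (3 - cfMax) / 5)) <
      moebiusLen c ((cfMax + 7) / 25) ((cfMax + 1) / 5) := by
  have hM := lt_cfMax
  have hM' := cfMax_lt
  obtain ⟨h1, h2, h3⟩ := largest_gap_image_bounds (k := 2) (x₀ := 0.3908) (y₀ := 0.4096)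
    (by norm_num) (by norm_num) (by norm_num) (by norm_num) (by norm_num)
  apply moebiusLen_lt_of_box (u₀ := 0.3117) (v₀ := 0.3582) hc _ _ h1 h2 h3 <;>
    linarith

lemma moebiusLen_image_three_lt {c : ℝ} (hc : 1 ≤ c) :
    moebiusLen c (1 / (3 + (cfMax + 2) / 5)) (1 / (3 + (3 - cfMax) / 5)) <
      moebiusLen c ((cfMax + 8) / 37) (cfMax / 3) := by
  have hM := lt_cfMax
  have hM' := cfMax_lt
  obtain ⟨h1, h2, h3⟩ := largest_gap_image_bounds (k := 3) (x₀ := 0.2810) (y₀ := 0.2906)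
    (by norm_num) (by norm_num) (by norm_num) (by norm_num) (by norm_num)
  apply moebiusLen_lt_of_box (u₀ := 0.2377) (v₀ := 0.2637) hc _ _ h1 h2 h3 <;>
    linarith

lemma moebiusLen_image_four_lt {c : ℝ} (hc : 1 ≤ c) :
    moebiusLen c (1 / (4 + (cfMax + 2) / 5)) (1 / (4 + (3 - cfMax) / 5)) <
      moebiusLen c ((cfMax + 8) / 37) (cfMax / 3) := by
  have hM := lt_cfMax
  have hM' := cfMax_lt
  obtain ⟨h1, h2, h3⟩ := largest_gap_image_bounds (k := 4) (x₀ := 0.2193) (y₀ := 0.2252)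
    (by norm_num) (by norm_num) (by norm_num) (by norm_num) (by norm_num)
  apply moebiusLen_lt_of_box (u₀ := 0.2377) (v₀ := 0.2637) hc _ _ h1 h2 h3 <;>
    linarith

lemma moebiusLen_gap43_lt_gap32 {c : ℝ} (hc : 1 ≤ c) :
    moebiusLen c ((cfMax + 8) / 37) (cfMax / 3) <
      moebiusLen c ((cfMax + 7) / 25) ((cfMax + 1) / 5) := by
  have hM := lt_cfMax
  have hM' := cfMax_lt
  apply moebiusLen_lt_of_box (x₀ := 0.2376) (y₀ := 0.2638) (u₀ := 0.3117) (v₀ := 0.3582) hc <;>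
    linarith

lemma moebiusLen_gap32_lt_gap21 {c : ℝ} (hc : 1 ≤ c) :
    moebiusLen c ((cfMax + 7) / 25) ((cfMax + 1) / 5) <
      moebiusLen c ((3 - cfMax) / 5) ((cfMax + 2) / 5) := by
  have hM := lt_cfMax
  have hM' := cfMax_lt
  apply moebiusLen_lt_of_box (x₀ := 0.3116) (y₀ := 0.3583) (u₀ := 0.4418) (v₀ := 0.5582) hc <;>
    linarith

lemma moebiusLen_image_le {k : ℕ} {x y c : ℝ} (hk : k ∈ ({1, 2, 3, 4} : Set ℕ)) (hc : 1 ≤ c)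
    (hxy : IsGap (tailSet k) x y) (h : moebiusLen (k + 1 / c) x y ≤
      moebiusLen (k + 1 / c) ((3 - cfMax) / 5) ((cfMax + 2) / 5)) :
    moebiusLen c (1 / (k + y)) (1 / (k + x)) ≤
      moebiusLen c (1 / (k + (cfMax + 2) / 5)) (1 / (k + (3 - cfMax) / 5)) := by
  have hM := lt_cfMax
  have hM' := cfMax_lt
  have hc0 : 0 < c := by linarith
  obtain ⟨hk1, -⟩ := digit_cast_bounds hk
  rw [moebiusLen_one_div_add hc0 (by linarith) (tailSet_pos hxy.2.1)
    (tailSet_pos hxy.2.2.1), moebiusLen_one_div_add hc0 (by linarith) (by linarith)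
    (by linarith)]
  gcongr

/-- The gap between the cylinders of the digits `2` and `1` is the longest. -/
lemma moebiusLen_gap_le {j : ℕ} {u v : ℝ} (h : IsGap (tailSet j) u v) :
    ∀ c, 1 ≤ c → moebiusLen c u v ≤ moebiusLen c ((3 - cfMax) / 5) ((cfMax + 2) / 5) := by
  have hM := lt_cfMax
  have hM' := cfMax_lt
  refine tailSet_gap_induction (P := fun _ u v => ∀ c, 1 ≤ c →
    moebiusLen c u v ≤ moebiusLen c ((3 - cfMax) / 5) ((cfMax + 2) / 5)) ?_ ?_ h
  · intro j b hb hjb c hc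
    have h32 := moebiusLen_gap32_lt_gap21 hc
    have h43 := moebiusLen_gap43_lt_gap32 hc
    rcases hb with rfl | rfl | rfl
    · norm_num only [Nat.cast_one, Nat.cast_ofNat, one_div_two_add_tailMin,
        one_div_one_add_cfMax]
      rfl
    · norm_num only [Nat.cast_ofNat, one_div_three_add_tailMin, one_div_two_add_cfMax]
      exact h32.le
    · norm_num only [Nat.cast_ofNat, one_div_four_add_tailMin, one_div_three_add_cfMax]
      exact (h43.trans h32).le
  · intro j k hk hjk x y hxy ih c hc
    have hc0 : 0 < c := by linarith
    have h32 := moebiusLen_gap32_lt_gap21 hc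
    have h43 := moebiusLen_gap43_lt_gap32 hc
    obtain ⟨hk1, -⟩ := digit_cast_bounds hk
    have h1 := moebiusLen_image_le hk hc hxy (ih _ (by linarith [one_div_pos.2 hc0]))
    refine h1.trans ?_
    rcases hk with rfl | rfl | rfl | rfl <;> push_cast
    · exact (moebiusLen_image_one_lt hc).le
    · exact ((moebiusLen_image_two_lt hc).trans h32).le
    · exact ((moebiusLen_image_three_lt hc).trans (h43.trans h32)).le
    · exact ((moebiusLen_image_four_lt hc).trans (h43.trans h32)).le

lemma moebiusLen_gap_le_of_mem_cylinder {j k : ℕ} (hk : k ∈ ({1, 2, 3, 4} : Set ℕ))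
    (hjk : (j, k) ∉ badPairs) {u v c : ℝ} (hc : 1 ≤ c) (h : IsGap (tailSet j) u v)
    (hu : 1 / (k + cfMax) ≤ u) (hv : v ≤ 1 / (k + tailMin k)) :
    moebiusLen c u v ≤
      moebiusLen c (1 / (k + (cfMax + 2) / 5)) (1 / (k + (3 - cfMax) / 5)) := by
  obtain ⟨s, -, t, -, rfl, rfl, hst, -, -⟩ := exists_isGap_of_mem_image
    (strictAntiOn_tailSet k k) (mapsTo_tailSet hk hjk) mem_image_tailSet (cfMax_mem_tailSet k)
    tailMin_mem_tailSet h hu hv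
  have hinv : 0 < 1 / c := one_div_pos.2 (by linarith)
  exact moebiusLen_image_le hk hc hst
    (moebiusLen_gap_le hst _ (by linarith [(digit_cast_bounds hk).1]))

section Base

variable {j : ℕ} {c : ℝ}

lemma cylinder_left_mem_tailSet {k : ℕ} (hk : k ∈ ({1, 2, 3, 4} : Set ℕ))
    (hjk : (j, k) ∉ badPairs) : 1 / (k + cfMax) ∈ tailSet j :=
  one_div_add_mem_tailSet hk hjk (cfMax_mem_tailSet k)

lemma cylinder_right_mem_tailSet {k : ℕ} (hk : k ∈ ({1, 2, 3, 4} : Set ℕ))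
    (hjk : (j, k) ∉ badPairs) : 1 / (k + tailMin k) ∈ tailSet j :=
  one_div_add_mem_tailSet hk hjk tailMin_mem_tailSet

lemma cfMax_div_three_mem_tailSet : cfMax / 3 ∈ tailSet j := by
  have := cylinder_left_mem_tailSet (j := j) (k := 3) (by simp) (not_mem_badPairs (by norm_num))
  rwa [Nat.cast_ofNat, one_div_three_add_cfMax] at this

lemma right_three_mem_tailSet : (cfMax + 7) / 25 ∈ tailSet j := by
  have := cylinder_right_mem_tailSet (j := j) (k := 3) (by simp) (not_mem_badPairs (by norm_num))
  rwa [Nat.cast_ofNat, one_div_three_add_tailMin] at this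

lemma left_two_mem_tailSet : (cfMax + 1) / 5 ∈ tailSet j := by
  have := cylinder_left_mem_tailSet (j := j) (k := 2) (by simp) (not_mem_badPairs (by norm_num))
  rwa [Nat.cast_ofNat, one_div_two_add_cfMax] at this

lemma right_two_mem_tailSet : (3 - cfMax) / 5 ∈ tailSet j := by
  have := cylinder_right_mem_tailSet (j := j) (k := 2) (by simp) (not_mem_badPairs (by norm_num))
  rwa [Nat.cast_ofNat, one_div_two_add_tailMin] at this

lemma gap_lt_of_mem_cylinder_one {u v : ℝ} (hc : 1 ≤ c) (h : IsGap (tailSet j) u v)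
    (hu : (cfMax + 2) / 5 ≤ u) (hv : v ≤ cfMax) :
    moebiusLen c u v < moebiusLen c ((3 - cfMax) / 5) ((cfMax + 2) / 5) := by
  refine lt_of_le_of_lt ?_ (moebiusLen_image_one_lt hc)
  have := moebiusLen_gap_le_of_mem_cylinder (k := 1) (by simp) (not_mem_badPairs (by norm_num))
    hc h (by rwa [Nat.cast_one, one_div_one_add_cfMax])
    (by rwa [Nat.cast_one, one_div_one_add_tailMin])
  rwa [Nat.cast_one] at this

lemma gap_lt_of_mem_cylinder_two {u v : ℝ} (hc : 1 ≤ c) (h : IsGap (tailSet j) u v)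
    (hu : (cfMax + 1) / 5 ≤ u) (hv : v ≤ (3 - cfMax) / 5) :
    moebiusLen c u v < moebiusLen c ((cfMax + 7) / 25) ((cfMax + 1) / 5) := by
  refine lt_of_le_of_lt ?_ (moebiusLen_image_two_lt hc)
  have := moebiusLen_gap_le_of_mem_cylinder (k := 2) (by simp) (not_mem_badPairs (by norm_num))
    hc h (by rwa [Nat.cast_ofNat, one_div_two_add_cfMax])
    (by rwa [Nat.cast_ofNat, one_div_two_add_tailMin])
  rwa [Nat.cast_ofNat] at this

lemma gap_lt_of_mem_cylinder_three {u v : ℝ} (hc : 1 ≤ c) (h : IsGap (tailSet j) u v)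
    (hu : cfMax / 3 ≤ u) (hv : v ≤ (cfMax + 7) / 25) :
    moebiusLen c u v < moebiusLen c ((cfMax + 8) / 37) (cfMax / 3) := by
  refine lt_of_le_of_lt ?_ (moebiusLen_image_three_lt hc)
  have := moebiusLen_gap_le_of_mem_cylinder (k := 3) (by simp) (not_mem_badPairs (by norm_num))
    hc h (by rwa [Nat.cast_ofNat, one_div_three_add_cfMax])
    (by rwa [Nat.cast_ofNat, one_div_three_add_tailMin])
  rwa [Nat.cast_ofNat] at this

lemma gap_lt_of_mem_cylinder_four (hj : (j, 4) ∉ badPairs) {u v : ℝ} (hc : 1 ≤ c)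
    (h : IsGap (tailSet j) u v) (hu : 1 - cfMax ≤ u) (hv : v ≤ (cfMax + 8) / 37) :
    moebiusLen c u v < moebiusLen c ((cfMax + 8) / 37) (cfMax / 3) := by
  refine lt_of_le_of_lt ?_ (moebiusLen_image_four_lt hc)
  have := moebiusLen_gap_le_of_mem_cylinder (k := 4) (by simp) hj
    hc h (by rwa [Nat.cast_ofNat, one_div_four_add_cfMax])
    (by rwa [Nat.cast_ofNat, one_div_four_add_tailMin])
  rwa [Nat.cast_ofNat] at this

lemma bridges_gap21 (hc1 : 1 ≤ c) (hc5 : c ≤ 5) :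
    HasLeftBridge (moebiusLen c) (26 / 25) (tailSet j) ((3 - cfMax) / 5) ((cfMax + 2) / 5) ∧
      HasRightBridge (moebiusLen c) (26 / 25) (tailSet j) ((3 - cfMax) / 5) ((cfMax + 2) / 5) := by
  have hM := lt_cfMax
  have hM' := cfMax_lt
  have hsq := cfMax_sq
  have h32 := moebiusLen_gap32_lt_gap21 hc1
  have h43 := moebiusLen_gap43_lt_gap32 hc1
  refine ⟨⟨_, cfMax_div_three_mem_tailSet, by linarith, ?_, fun u v h hu hv => ?_⟩,
    ⟨_, cfMax_mem_tailSet j, by linarith, ?_,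
      fun u v h hu hv => gap_lt_of_mem_cylinder_one hc1 h hu hv⟩⟩
  · apply mul_moebiusLen_le_left <;> try linarith
    apply le_of_endpoints hc1 hc5 <;> nlinarith
  · rcases h.le_or_ge right_three_mem_tailSet with h1 | h1
    · exact (gap_lt_of_mem_cylinder_three hc1 h hu h1).trans (h43.trans h32)
    rcases h.le_or_ge left_two_mem_tailSet with h2 | h2
    · exact (moebiusLen_mono (by linarith) h1 h.1.le h2).trans_lt h32
    · exact (gap_lt_of_mem_cylinder_two hc1 h h2 hv).trans h32
  · apply mul_moebiusLen_le_right <;> try linarith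
    apply le_of_endpoints hc1 hc5 <;> nlinarith

lemma bridges_gap32 (hc1 : 1 ≤ c) (hc5 : c ≤ 5) :
    HasLeftBridge (moebiusLen c) (26 / 25) (tailSet j) ((cfMax + 7) / 25) ((cfMax + 1) / 5) ∧
      HasRightBridge (moebiusLen c) (26 / 25) (tailSet j) ((cfMax + 7) / 25) ((cfMax + 1) / 5) := by
  have hM := lt_cfMax
  have hM' := cfMax_lt
  have hsq := cfMax_sq
  refine ⟨⟨_, cfMax_div_three_mem_tailSet, by linarith, ?_, fun u v h hu hv =>
      (gap_lt_of_mem_cylinder_three hc1 h hu hv).trans (moebiusLen_gap43_lt_gap32 hc1)⟩,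
    ⟨_, right_two_mem_tailSet, by linarith, ?_,
      fun u v h hu hv => gap_lt_of_mem_cylinder_two hc1 h hu hv⟩⟩
  · apply mul_moebiusLen_le_left <;> try linarith
    apply le_of_endpoints hc1 hc5 <;> nlinarith
  · apply mul_moebiusLen_le_right <;> try linarith
    apply le_of_endpoints hc1 hc5 <;> nlinarith

lemma bridges_gap43 (hj : (j, 4) ∉ badPairs) (hc1 : 1 ≤ c) (hc5 : c ≤ 5) :
    HasLeftBridge (moebiusLen c) (26 / 25) (tailSet j) ((cfMax + 8) / 37) (cfMax / 3) ∧
      HasRightBridge (moebiusLen c) (26 / 25) (tailSet j) ((cfMax + 8) / 37) (cfMax / 3) := by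
  have hM := lt_cfMax
  have hM' := cfMax_lt
  have hsq := cfMax_sq
  have hmem : 1 - cfMax ∈ tailSet j := by
    have := cylinder_left_mem_tailSet (j := j) (k := 4) (by simp) hj
    rwa [Nat.cast_ofNat, one_div_four_add_cfMax] at this
  refine ⟨⟨_, hmem, by linarith, ?_, fun u v h hu hv =>
      gap_lt_of_mem_cylinder_four hj hc1 h hu hv⟩,
    ⟨_, right_three_mem_tailSet, by linarith, ?_,
      fun u v h hu hv => gap_lt_of_mem_cylinder_three hc1 h hu hv⟩⟩
  · apply mul_moebiusLen_le_left <;> try linarith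
    apply le_of_endpoints hc1 hc5 <;> nlinarith
  · apply mul_moebiusLen_le_right <;> try linarith
    apply le_of_endpoints hc1 hc5 <;> nlinarith

end Base

/-- Every gap of `K` has bridges on both sides which are at least `τ` times as long, for the
length function `ρ`. -/
def HasBridges (ρ : ℝ → ℝ → ℝ) (τ : ℝ) (K : Set ℝ) : Prop :=
  ∀ u v, IsGap K u v → HasLeftBridge ρ τ K u v ∧ HasRightBridge ρ τ K u v

lemma add_one_div_mem_Icc {k : ℕ} (hk : k ∈ ({1, 2, 3, 4} : Set ℕ)) {c : ℝ} (hc : 1 ≤ c) :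
    (k : ℝ) + 1 / c ∈ Icc (1 : ℝ) 5 := by
  obtain ⟨h1, h2⟩ := digit_cast_bounds hk
  have h3 : 0 < 1 / c := one_div_pos.2 (by linarith)
  have h4 : 1 / c ≤ 1 := by
    rw [div_le_one (by linarith)]
    exact hc
  exact ⟨by linarith, by linarith⟩

lemma hasBridges_tailSet {j : ℕ} {c : ℝ} (hc : c ∈ Icc (1 : ℝ) 5) :
    HasBridges (moebiusLen c) (26 / 25) (tailSet j) := by
  intro u v h
  refine tailSet_gap_induction (P := fun j u v => ∀ c ∈ Icc (1 : ℝ) 5,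
    HasLeftBridge (moebiusLen c) (26 / 25) (tailSet j) u v ∧
      HasRightBridge (moebiusLen c) (26 / 25) (tailSet j) u v) ?_ ?_ h c hc
  · intro j b hb hjb c hc
    rcases hb with rfl | rfl | rfl
    · norm_num only [Nat.cast_one, Nat.cast_ofNat, one_div_two_add_tailMin,
        one_div_one_add_cfMax]
      exact bridges_gap21 hc.1 hc.2
    · norm_num only [Nat.cast_ofNat, one_div_three_add_tailMin, one_div_two_add_cfMax]
      exact bridges_gap32 hc.1 hc.2
    · norm_num only [Nat.cast_ofNat, one_div_four_add_tailMin, one_div_three_add_cfMax]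
      exact bridges_gap43 hjb hc.1 hc.2
  · intro j k hk hjk x y hxy ih c hc
    have hc0 : 0 < c := by linarith [hc.1]
    obtain ⟨hl, hr⟩ := ih _ (add_one_div_mem_Icc hk hc.1)
    have hρ : ∀ x ∈ tailSet k, ∀ y ∈ tailSet k, moebiusLen c (1 / (k + y)) (1 / (k + x)) =
        1 / c ^ 2 * moebiusLen (k + 1 / c) x y := fun x hx y hy =>
      moebiusLen_one_div_add hc0 k.cast_nonneg (tailSet_pos hx) (tailSet_pos hy)
    exact ⟨hr.image (f := fun t => 1 / ((k : ℝ) + t)) (strictAntiOn_tailSet k k)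
        (mapsTo_tailSet hk hjk) mem_image_tailSet (by positivity) hρ hxy.2.1 hxy.2.2.1,
      hl.image (f := fun t => 1 / ((k : ℝ) + t)) (strictAntiOn_tailSet k k)
        (mapsTo_tailSet hk hjk) mem_image_tailSet (by positivity) hρ hxy.2.1 hxy.2.2.1⟩

/-! ### The sets `Kb b` -/

lemma HasBridges.image {A : Set ℝ} {f : ℝ → ℝ} {ρ ρ' : ℝ → ℝ → ℝ} {l τ : ℝ}
    (h : HasBridges ρ τ A) (hanti : StrictAntiOn f A) (hl : 0 < l)
    (hρ : ∀ x ∈ A, ∀ y ∈ A, ρ' (f y) (f x) = l * ρ x y) : HasBridges ρ' τ (f '' A) := by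
  intro u v huv
  obtain ⟨y, hy, rfl⟩ := huv.2.1
  obtain ⟨x, hx, rfl⟩ := huv.2.2.1
  obtain ⟨h1, h2⟩ := h x y (huv.of_image hanti (mapsTo_image f A) hx hy)
  have hconv : ∀ x ∈ A, ∀ y ∈ A, ∀ w ∈ f '' A, f x ≤ w → w ≤ f y → w ∈ f '' A :=
    fun _ _ _ _ _ hw _ _ => hw
  exact ⟨h2.image hanti (mapsTo_image f A) hconv hl hρ hx hy,
    h1.image hanti (mapsTo_image f A) hconv hl hρ hx hy⟩

lemma HasBridges.one_div_add_image {A : Set ℝ} {τ : ℝ} {k : ℕ} (hk : k ∈ ({1, 2, 3, 4} : Set ℕ))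
    (hA : ∀ x ∈ A, 0 < x) (h : ∀ c ∈ Icc (1 : ℝ) 5, HasBridges (moebiusLen c) τ A) :
    (∀ c ∈ Icc (1 : ℝ) 5, HasBridges (moebiusLen c) τ ((fun t => 1 / ((k : ℝ) + t)) '' A)) ∧
      HasBridges (fun x y => y - x) τ ((fun t => 1 / ((k : ℝ) + t)) '' A) := by
  have hanti := strictAntiOn_one_div_add k.cast_nonneg hA
  constructor
  · intro c hc
    have hc0 : 0 < c := by linarith [hc.1]
    exact (h _ (add_one_div_mem_Icc hk hc.1)).image hanti (l := 1 / c ^ 2) (by positivity)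
      fun x hx y hy => moebiusLen_one_div_add hc0 k.cast_nonneg (hA x hx) (hA y hy)
  · obtain ⟨h1, h2⟩ := digit_cast_bounds hk
    exact (h k ⟨h1, by linarith⟩).image hanti one_pos fun x _ y _ => by simp [moebiusLen]

lemma Kb_singleton {d : ℕ} (hd : d ∈ ({1, 2, 3, 4} : Set ℕ)) :
    Kb [d] = (fun t => 1 / ((d : ℝ) + t)) '' tailSet d := by
  ext x
  constructor
  · rintro ⟨θ, hθ, h, rfl⟩
    refine ⟨_, ⟨θ, hθ, h d rfl, rfl⟩, ?_⟩
    rw [cfVal_app_cons (by simpa using hd) hθ.1, app_nil]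
  · rintro ⟨-, ⟨θ, hθ, h, rfl⟩, rfl⟩
    refine ⟨θ, hθ, fun e he => ?_, ?_⟩
    · obtain rfl : d = e := by simpa using he
      exact h
    · rw [cfVal_app_cons (by simpa using hd) hθ.1, app_nil]

lemma Kb_cons_cons {d e : ℕ} {w : List ℕ} (hw : ∀ i ∈ d :: e :: w, i ∈ ({1, 2, 3, 4} : Set ℕ)) :
    Kb (d :: e :: w) = (fun t => 1 / ((d : ℝ) + t)) '' Kb (e :: w) := by
  ext x
  constructor
  · rintro ⟨θ, hθ, h, rfl⟩
    rw [List.getLast?_cons_cons] at h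
    exact ⟨_, ⟨θ, hθ, h, rfl⟩, (cfVal_app_cons hw hθ.1).symm⟩
  · rintro ⟨-, ⟨θ, hθ, h, rfl⟩, rfl⟩
    refine ⟨θ, hθ, ?_, (cfVal_app_cons hw hθ.1).symm⟩
    rwa [List.getLast?_cons_cons]

lemma Kb_pos {b : List ℕ} (hb : ∀ d ∈ b, d ∈ ({1, 2, 3, 4} : Set ℕ)) {x : ℝ} (hx : x ∈ Kb b) :
    0 < x := by
  obtain ⟨θ, hθ, -, rfl⟩ := hx
  linarith [(cfVal_mem_Icc (app_mem_digitSeqs hb hθ.1)).1]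

lemma hasBridges_Kb {b : List ℕ} (hb : b ≠ []) (hdig : ∀ d ∈ b, d ∈ ({1, 2, 3, 4} : Set ℕ)) :
    (∀ c ∈ Icc (1 : ℝ) 5, HasBridges (moebiusLen c) (26 / 25) (Kb b)) ∧
      HasBridges (fun x y => y - x) (26 / 25) (Kb b) := by
  induction b with
  | nil => exact absurd rfl hb
  | cons d w ih =>
    have hd : d ∈ ({1, 2, 3, 4} : Set ℕ) := hdig d (by simp)
    cases w with
    | nil =>
      rw [Kb_singleton hd]
      exact HasBridges.one_div_add_image hd (fun _ hx => tailSet_pos hx)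
        fun c hc => hasBridges_tailSet hc
    | cons e w =>
      have hw : ∀ i ∈ e :: w, i ∈ ({1, 2, 3, 4} : Set ℕ) :=
        fun i hi => hdig i (List.mem_cons_of_mem d hi)
      rw [Kb_cons_cons hdig]
      exact HasBridges.one_div_add_image hd (fun _ hx => Kb_pos hw hx)
        (ih (List.cons_ne_nil e w) hw).1

/-- The sequences of `D` which may follow the word `b`. -/
def followers (b : List ℕ) : Set (ℕ → ℕ) :=
  {θ | θ ∈ Dset ∧ ∀ d, b.getLast? = some d → (d, θ 0) ∉ badPairs}

lemma Kb_eq_image (b : List ℕ) : Kb b = (fun θ => cfVal (app b θ)) '' followers b := by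
  ext x
  constructor
  · rintro ⟨θ, hθ, h, rfl⟩
    exact ⟨θ, ⟨hθ, h⟩, rfl⟩
  · rintro ⟨θ, ⟨hθ, h⟩, rfl⟩
    exact ⟨θ, hθ, h, rfl⟩

lemma isCompact_followers (b : List ℕ) : IsCompact (followers b) := by
  have hcl : IsClosed (followers b) := by
    have h : followers b = (⋂ n, (fun θ : ℕ → ℕ => θ n) ⁻¹' {1, 2, 3, 4}) ∩
        (⋂ n, (fun θ : ℕ → ℕ => (θ n, θ (n + 1))) ⁻¹' badPairsᶜ) ∩
        ⋂ d, ⋂ _ : b.getLast? = some d, (fun θ : ℕ → ℕ => (d, θ 0)) ⁻¹' badPairsᶜ := by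
      ext θ
      simp only [followers, Dset, mem_ofPred_eq, mem_inter_iff, mem_iInter, mem_preimage,
        mem_compl_iff]
    rw [h]
    refine ((isClosed_iInter fun n => ?_).inter (isClosed_iInter fun n => ?_)).inter
      (isClosed_iInter fun d => isClosed_iInter fun _ => ?_) <;>
    exact (isClosed_discrete _).preimage (by fun_prop)
  have hK : IsCompact (Set.univ.pi fun _ : ℕ => ({1, 2, 3, 4} : Set ℕ)) :=
    isCompact_univ_pi fun _ => (Set.toFinite _).isCompact
  exact hK.of_isClosed_subset hcl fun θ hθ n _ => hθ.1.1 n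

lemma continuous_app (b : List ℕ) : Continuous (app b) := by
  refine continuous_pi fun n => ?_
  by_cases h : n < b.length
  · simpa only [app, h, dite_true] using continuous_const
  · simpa only [app, h, dite_false] using continuous_apply _

lemma continuousOn_cfVal_app {b : List ℕ} (hb : ∀ d ∈ b, d ∈ ({1, 2, 3, 4} : Set ℕ)) :
    ContinuousOn (fun θ => cfVal (app b θ)) (followers b) :=
  continuousOn_cfVal.comp (continuous_app b).continuousOn
    fun _ hθ => app_mem_digitSeqs hb hθ.1.1

lemma injOn_cfVal_app {b : List ℕ} (hb : ∀ d ∈ b, d ∈ ({1, 2, 3, 4} : Set ℕ)) :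
    InjOn (fun θ => cfVal (app b θ)) Dset := by
  induction b with
  | nil => simpa only [app_nil] using cfVal_injOn
  | cons d w ih =>
    have hw : ∀ i ∈ w, i ∈ ({1, 2, 3, 4} : Set ℕ) :=
      fun i hi => hb i (List.mem_cons_of_mem d hi)
    intro θ hθ η hη h
    refine ih hw hθ hη ?_
    have h1 := (cfVal_mem_Icc (app_mem_digitSeqs hw hθ.1)).1
    have h2 := (cfVal_mem_Icc (app_mem_digitSeqs hw hη.1)).1
    simp only [cfVal_app_cons hb hθ.1, cfVal_app_cons hb hη.1, one_div, inv_inj] at h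
    exact add_left_cancel h

lemma exists_followers_ne {b : List ℕ} {θ : ℕ → ℕ} (hθ : θ ∈ followers b) (n : ℕ) :
    ∃ η ∈ followers b, η ≠ θ ∧ ∀ i < n, η i = θ i := by
  obtain ⟨e, he1, he2, he3⟩ : ∃ e : ℕ, 1 ≤ e ∧ e ≤ 2 ∧ e ≠ θ n := by
    by_cases h : θ n = 1
    · exact ⟨2, by omega, by omega, by omega⟩
    · exact ⟨1, by omega, by omega, by omega⟩
  have hval : ∀ i, (fun i => if i < n then θ i else e) i ≤ 3 ∨
      (fun i => if i < n then θ i else e) i = θ i ∧ i < n := by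
    intro i
    by_cases h : i < n
    · exact Or.inr ⟨if_pos h, h⟩
    · left
      simp only [h, if_false]
      omega
  refine ⟨fun i => if i < n then θ i else e, ⟨⟨fun i => ?_, fun i => ?_⟩, fun d hd => ?_⟩,
    fun h => ?_, fun i hi => if_pos hi⟩
  · by_cases h : i < n
    · simpa only [h, if_true] using hθ.1.1 i
    · simp only [h, if_false, mem_insert_iff, mem_singleton_iff]
      omega
  · rcases hval (i + 1) with h | ⟨h, hi⟩
    · exact not_mem_badPairs h
    · have hi' : i < n := by omega
      simp only [hi, hi', if_true]
      exact hθ.1.2 i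
  · rcases hval 0 with h | ⟨h, hi⟩
    · exact not_mem_badPairs h
    · simp only [hi, if_true]
      exact hθ.2 d hd
  · have := congrFun h n
    simp only [lt_irrefl, if_false] at this
    exact he3 this

lemma isCantorSet_Kb {b : List ℕ} (hb : ∀ d ∈ b, d ∈ ({1, 2, 3, 4} : Set ℕ)) :
    IsCantorSet (Kb b) := by
  have hinj : InjOn (fun θ => cfVal (app b θ)) (followers b) :=
    (injOn_cfVal_app hb).mono fun _ h => h.1
  have hcpt : IsCompact (Kb b) := by
    rw [Kb_eq_image]
    exact (isCompact_followers b).image_of_continuousOn (continuousOn_cfVal_app hb)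
  refine ⟨hcpt, ⟨hcpt.isClosed, ?_⟩, ?_⟩
  · intro x hx
    rw [Kb_eq_image] at hx ⊢
    obtain ⟨θ, hθ, rfl⟩ := hx
    rw [accPt_iff_nhds]
    intro U hU
    obtain ⟨ε, hε, hεU⟩ := Metric.mem_nhds_iff.1 hU
    obtain ⟨n, hn⟩ := exists_pow_lt_of_lt_one hε (by norm_num : (25 / 36 : ℝ) < 1)
    obtain ⟨η, hη, hne, heq⟩ := exists_followers_ne hθ n
    refine ⟨cfVal (app b η), ⟨hεU ?_, η, hη, rfl⟩, fun h => hne (hinj hη hθ h)⟩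
    refine (abs_cfVal_sub_le n (app_mem_digitSeqs hb hη.1.1) (app_mem_digitSeqs hb hθ.1.1)
      fun i hi => ?_).trans_lt hn
    by_cases h : i < b.length
    · simp only [app, h, dite_true]
    · simp only [app, h, dite_false]
      exact heq _ (by omega)
  · have : CompactSpace (followers b) := isCompact_iff_compactSpace.1 (isCompact_followers b)
    have hemb := ((continuousOn_cfVal_app hb).domRestrict.isClosedEmbedding
      hinj.injective).isEmbedding
    have := hemb.isTotallyDisconnected_range.2 inferInstance
    rwa [range_domRestrict, ← Kb_eq_image] at this

lemma Kb_nonempty (b : List ℕ) : (Kb b).Nonempty :=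
  ⟨_, per13, per13_mem_Dset, fun _ _ => not_mem_badPairs (by simp [per13]), rfl⟩

/-! ### Thickness -/

lemma IsCantorSet.exists_isGap {K : Set ℝ} (h : IsCantorSet K) (hne : K.Nonempty) :
    ∃ u v, IsGap K u v := by
  obtain ⟨x, hx⟩ := hne
  obtain ⟨y, ⟨-, hy⟩, hyx⟩ := accPt_iff_nhds.1 (h.2.1.acc x hx) univ univ_mem
  wlog hxy : x < y generalizing x y
  · exact this y hy x hyx.symm hx (lt_of_le_of_ne (not_lt.1 hxy) hyx)
  obtain ⟨z, hz, hzK⟩ : ∃ z ∈ Icc x y, z ∉ K := by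
    by_contra! hc
    exact hyx (h.2.2 _ hc isPreconnected_Icc (right_mem_Icc.2 hxy.le) (left_mem_Icc.2 hxy.le))
  have hl := (h.1.inter_right (isClosed_Iic (a := z))).isGreatest_sSup ⟨x, hx, hz.1⟩
  have hr := (h.1.inter_right (isClosed_Ici (a := z))).isLeast_sInf ⟨y, hy, hz.2⟩
  refine ⟨_, _, lt_of_le_of_ne (hl.1.2.trans hr.1.2) fun he => ?_, hl.1.1, hr.1.1, ?_⟩
  · have h1 : sSup (K ∩ Iic z) = z := le_antisymm hl.1.2 (he ▸ hr.1.2)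
    exact hzK (h1 ▸ hl.1.1)
  · rw [eq_empty_iff_forall_notMem]
    rintro w ⟨⟨h1, h2⟩, hw⟩
    rcases le_total w z with h3 | h3
    · exact h1.not_ge (hl.2 ⟨hw, h3⟩)
    · exact h2.not_ge (hr.2 ⟨hw, h3⟩)

lemma HasLeftBridge.le_leftBridgeLen {K : Set ℝ} {τ u v : ℝ} (hK : IsCompact K)
    (h : HasLeftBridge (fun x y => y - x) τ K u v) : τ * (v - u) ≤ leftBridgeLen K u v := by
  obtain ⟨p, hp, -, h1, h2⟩ := h
  have : sSup ({sInf K} ∪ {d | ∃ c, IsGap K c d ∧ d ≤ u ∧ v - u ≤ d - c}) ≤ p := by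
    refine csSup_le ⟨_, Or.inl rfl⟩ ?_
    rintro d (rfl | ⟨c, hcd, hdu, hlen⟩)
    · exact csInf_le hK.bddBelow hp
    · rcases hcd.le_or_ge hp with h3 | h3
      · exact h3
      · exact absurd (h2 c d hcd h3 hdu) hlen.not_gt
  unfold leftBridgeLen
  linarith

lemma HasRightBridge.le_rightBridgeLen {K : Set ℝ} {τ u v : ℝ} (hK : IsCompact K)
    (h : HasRightBridge (fun x y => y - x) τ K u v) : τ * (v - u) ≤ rightBridgeLen K u v := by
  obtain ⟨p, hp, -, h1, h2⟩ := h
  have : p ≤ sInf ({sSup K} ∪ {c | ∃ d, IsGap K c d ∧ v ≤ c ∧ v - u ≤ d - c}) := by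
    refine le_csInf ⟨_, Or.inl rfl⟩ ?_
    rintro c (rfl | ⟨d, hcd, hvc, hlen⟩)
    · exact le_csSup hK.bddAbove hp
    · rcases hcd.le_or_ge hp with h3 | h3
      · exact absurd (h2 c d hcd hvc h3) hlen.not_gt
      · exact h3
  unfold rightBridgeLen
  linarith

lemma HasBridges.le_thickness {K : Set ℝ} {τ : ℝ} (hK : IsCompact K)
    (hgap : ∃ u v, IsGap K u v) (h : HasBridges (fun x y => y - x) τ K) : τ ≤ thickness K := by
  obtain ⟨u, v, huv⟩ := hgap
  refine le_csInf ⟨_, u, v, huv, rfl⟩ ?_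
  rintro - ⟨a, b, hab, rfl⟩
  obtain ⟨hl, hr⟩ := h a b hab
  rw [le_div_iff₀ (sub_pos.2 hab.1)]
  exact le_min (hl.le_leftBridgeLen hK) (hr.le_rightBridgeLen hK)

/-- For every nonempty word `b` with digits in `{1,2,3,4}`, the set `K(b)` is a
Cantor set of thickness greater than `1.03`. -/
theorem Kb_thickness (b : List ℕ) (hb : b ≠ [])
    (hdig : ∀ d ∈ b, d ∈ ({1, 2, 3, 4} : Set ℕ)) :
    IsCantorSet (Kb b) ∧ 1.03 < thickness (Kb b) := by
  have hC := isCantorSet_Kb hdig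
  refine ⟨hC, lt_of_lt_of_le (by norm_num) ((hasBridges_Kb hb hdig).2.le_thickness hC.1
    (hC.exists_isGap (Kb_nonempty b)))⟩
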